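/- Let V be a finite set of points of the circle ℝ/ℤ, let ℐ be a finite family of arcs of the circle, where an arc is the image of a closed bounded real interval under the quotient map ℝ → ℝ/ℤ, and let (U, W) be a partition of V. Let G be the graph on V in which distinct u ∈ U and w ∈ W are adjacent exactly when some arc I ∈ ℐ contains both u and w (no edges inside U or inside W). If G has at least one edge, then both U and W contain a rare vertex of G. -/

import Mathlib

/-- A set of vertices is stable (independent): no two of its vertices are adjacent. -/
def IsStable {V : Type*} (G : SimpleGraph V) (S : Set V) : Prop :=
  ∀ ⦃u⦄, u ∈ S → ∀ ⦃v⦄, v ∈ S → ¬G.Adj u v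

/-- A maximal stable set: stable, and every vertex outside has a neighbour inside. -/
def IsMaxStable {V : Type*} (G : SimpleGraph V) (S : Set V) : Prop :=
  IsStable G S ∧ ∀ v ∉ S, ∃ u ∈ S, G.Adj v u

/-- The set of all maximal stable sets of `G`. -/
def MSS {V : Type*} (G : SimpleGraph V) : Set (Set V) := {S | IsMaxStable G S}

/-- The number of maximal stable sets of `G` containing all vertices of `X`. -/
noncomputable def mssOn {V : Type*} (G : SimpleGraph V) (X : Set V) : ℕ :=
  {S | S ∈ MSS G ∧ X ⊆ S}.ncard

/-- A vertex is rare if it lies in at most half of the maximal stable sets. -/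
def Rare {V : Type*} (G : SimpleGraph V) (v : V) : Prop :=
  2 * mssOn G {v} ≤ (MSS G).ncard

/-- The neighbourhood of a set of vertices: all vertices with a neighbour in `A`. -/
def NSet {V : Type*} (G : SimpleGraph V) (A : Set V) : Set V := {v | ∃ u ∈ A, G.Adj v u}

/-- A bipartition of `G`: a partition of the vertex set into two stable sets. -/
def IsBipartition {V : Type*} (G : SimpleGraph V) (U W : Set V) : Prop :=
  U ∪ W = Set.univ ∧ Disjoint U W ∧ IsStable G U ∧ IsStable G W

theorem IsBipartition.symm {V : Type*} {G : SimpleGraph V} {U W : Set V}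
    (h : IsBipartition G U W) : IsBipartition G W U :=
  ⟨by rw [Set.union_comm, h.1], h.2.1.symm, h.2.2.2, h.2.2.1⟩

theorem IsBipartition.mem_or_mem {V : Type*} {G : SimpleGraph V} {U W : Set V}
    (h : IsBipartition G U W) (v : V) : v ∈ U ∨ v ∈ W := by
  have : v ∈ U ∪ W := h.1 ▸ Set.mem_univ v
  exact this

theorem IsBipartition.mem_left_of_adj {V : Type*} {G : SimpleGraph V} {U W : Set V}
    (h : IsBipartition G U W) {v w : V} (hw : w ∈ W) (hvw : G.Adj w v) : v ∈ U :=
  (h.mem_or_mem v).resolve_right fun hv => h.2.2.2 hw hv hvw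

/-- The stable set obtained from `S` by removing the neighbourhood of `w` from the class `U`
and extending maximally in the class `W`. -/
def removeNeighbors {V : Type*} (G : SimpleGraph V) (U W : Set V) (w : V) (S : Set V) : Set V :=
  {u | u ∈ U ∧ u ∈ S ∧ ¬G.Adj w u} ∪ {v | v ∈ W ∧ ∀ u ∈ S, G.Adj v u → G.Adj w u}

theorem mem_removeNeighbors_of_mem_left {V : Type*} {G : SimpleGraph V} {U W : Set V}
    (h : IsBipartition G U W) {w u : V} (hu : u ∈ U) (S : Set V) :
    u ∈ removeNeighbors G U W w S ↔ u ∈ S ∧ ¬G.Adj w u := by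
  have : u ∉ W := fun h' => Set.disjoint_left.1 h.2.1 hu h'
  simp [removeNeighbors, hu, this]

theorem isMaxStable_removeNeighbors {V : Type*} {G : SimpleGraph V} {U W : Set V}
    (h : IsBipartition G U W) {w : V} (hw : w ∈ W) {S : Set V} (hS : IsMaxStable G S) :
    IsMaxStable G (removeNeighbors G U W w S) := by
  constructor
  · rintro u (hu | hu) v (hv | hv) huv
    · exact h.2.2.1 hu.1 hv.1 huv
    · exact hu.2.2 (hv.2 u hu.2.1 huv.symm)
    · exact hv.2.2 (hu.2 v hv.2.1 huv)
    · exact h.2.2.2 hu.1 hv.1 huv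
  · intro v hv
    rcases h.mem_or_mem v with hvU | hvW
    · rw [mem_removeNeighbors_of_mem_left h hvU] at hv
      by_cases hvS : v ∈ S
      · have hwv : G.Adj w v := by tauto
        exact ⟨w, Or.inr ⟨hw, fun u _ hu => hu⟩, hwv.symm⟩
      · obtain ⟨x, hxS, hvx⟩ := hS.2 v hvS
        exact ⟨x, Or.inr ⟨h.symm.mem_left_of_adj hvU hvx,
          fun u hu hxu => absurd hxu (hS.1 hxS hu)⟩, hvx⟩
    · have : ∃ u ∈ S, G.Adj v u ∧ ¬G.Adj w u := by
        by_contra! hcon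
        exact hv (Or.inr ⟨hvW, hcon⟩)
      obtain ⟨u, huS, hvu, hwu⟩ := this
      exact ⟨u, Or.inl ⟨h.mem_left_of_adj hvW hvu, huS, hwu⟩, hvu⟩

theorem IsMaxStable.subset_of_inter_subset {V : Type*} {G : SimpleGraph V} {U W : Set V}
    (h : IsBipartition G U W) {S T : Set V} (hS : IsMaxStable G S) (hT : IsMaxStable G T)
    (hST : ∀ u ∈ U, u ∈ S ↔ u ∈ T) : S ⊆ T := by
  intro v hv
  rcases h.mem_or_mem v with hvU | hvW
  · exact (hST v hvU).1 hv
  · by_contra hvT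
    obtain ⟨u, huT, hvu⟩ := hT.2 v hvT
    exact hS.1 hv ((hST u (h.mem_left_of_adj hvW hvu)).2 huT) hvu

theorem removeNeighbors_injOn {V : Type*} {G : SimpleGraph V} {U W : Set V}
    (h : IsBipartition G U W) (w : V) :
    Set.InjOn (removeNeighbors G U W w) {S | S ∈ MSS G ∧ G.neighborSet w ⊆ S} := by
  rintro S ⟨hS, hwS⟩ T ⟨hT, hwT⟩ hST
  have key : ∀ u ∈ U, u ∈ S ↔ u ∈ T := by
    intro u hu
    by_cases hwu : G.Adj w u
    · exact iff_of_true (hwS hwu) (hwT hwu)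
    · have := Set.ext_iff.1 hST u
      rw [mem_removeNeighbors_of_mem_left h hu, mem_removeNeighbors_of_mem_left h hu] at this
      tauto
  exact (IsMaxStable.subset_of_inter_subset h hS hT key).antisymm
    (IsMaxStable.subset_of_inter_subset h hT hS fun u hu => (key u hu).symm)

/-- If every neighbourhood that meets `N(w)` contains one of two vertices `a, b ∈ N(w)`,
then one of `a, b` is rare. -/
theorem rare_or_rare {V : Type*} [Finite V] {G : SimpleGraph V} {U W : Set V}
    (h : IsBipartition G U W) {w a b : V} (hw : w ∈ W) (ha : G.Adj w a) (hb : G.Adj w b)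
    (hab : ∀ v ∈ W, ∀ c, G.Adj w c → G.Adj v c → G.Adj v a ∨ G.Adj v b) :
    Rare G a ∨ Rare G b := by
  have haU := h.mem_left_of_adj hw ha
  have hbU := h.mem_left_of_adj hw hb
  set A := {S | S ∈ MSS G ∧ a ∈ S} with hA
  set B := {S | S ∈ MSS G ∧ b ∈ S} with hB
  have hle : (A ∩ B).ncard ≤ (MSS G \ (A ∪ B)).ncard := by
    refine Set.ncard_le_ncard_of_injOn (removeNeighbors G U W w) ?_
      ((removeNeighbors_injOn h w).mono ?_)
    · rintro S ⟨⟨hS, -⟩, -⟩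
      refine ⟨isMaxStable_removeNeighbors h hw hS, ?_⟩
      rintro (⟨-, hmem⟩ | ⟨-, hmem⟩)
      · exact ((mem_removeNeighbors_of_mem_left h haU S).1 hmem).2 ha
      · exact ((mem_removeNeighbors_of_mem_left h hbU S).1 hmem).2 hb
    · rintro S ⟨⟨hS, haS⟩, -, hbS⟩
      refine ⟨hS, fun c hwc => ?_⟩
      by_contra hcS
      obtain ⟨v, hvS, hcv⟩ := hS.2 c hcS
      rcases hab v (h.symm.mem_left_of_adj (h.mem_left_of_adj hw hwc) hcv) c hwc hcv.symm
        with hv | hv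
      · exact hS.1 hvS haS hv
      · exact hS.1 hvS hbS hv
  have hsub : A ∪ B ⊆ MSS G := by
    rintro S (hS | hS) <;> exact hS.1
  have h1 := Set.ncard_union_add_ncard_inter A B
  have h2 := Set.ncard_sdiff_add_ncard_of_subset hsub
  have h3 : mssOn G {a} = A.ncard := by simp [mssOn, hA]
  have h4 : mssOn G {b} = B.ncard := by simp [mssOn, hB]
  unfold Rare
  omega

/-- If the neighbourhoods of the vertices of `W` are traces of images of real intervals that
can be moved to any lift of any of their points, then `U` contains a rare vertex. -/
theorem exists_rare_of_ordConnected {V X : Type*} [Finite V] {G : SimpleGraph V} {U W : Set V}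
    (h : IsBipartition G U W) (π : ℝ → X) (hπ : Function.Surjective π) (f : V → X)
    (hJ : ∀ w ∈ W, ∀ u, G.Adj w u → ∀ x, π x = f u →
      ∃ J : Set ℝ, J.OrdConnected ∧ x ∈ J ∧ ∀ v ∈ U, G.Adj w v ↔ f v ∈ π '' J)
    (he : ∃ w ∈ W, ∃ u, G.Adj w u) : ∃ u ∈ U, Rare G u := by
  obtain ⟨w, ⟨hw, u, hwu⟩, hmin⟩ := Set.exists_min_image {w | w ∈ W ∧ ∃ u, G.Adj w u}
    (fun w => (G.neighborSet w).ncard) (Set.toFinite _) he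
  obtain ⟨x, hx⟩ := hπ (f u)
  obtain ⟨J, hJo, -, hJw⟩ := hJ w hw u hwu x hx
  have hlift : ∀ v, ∃ y, G.Adj w v → y ∈ J ∧ π y = f v := by
    intro v
    by_cases hv : G.Adj w v
    · obtain ⟨y, hy⟩ := (hJw v (h.mem_left_of_adj hw hv)).1 hv
      exact ⟨y, fun _ => hy⟩
    · exact ⟨0, fun h' => absurd h' hv⟩
  choose g hg using hlift
  obtain ⟨a, ha, hamin⟩ := Set.exists_min_image (G.neighborSet w) g (Set.toFinite _) ⟨u, hwu⟩
  obtain ⟨b, hb, hbmax⟩ := Set.exists_max_image (G.neighborSet w) g (Set.toFinite _) ⟨u, hwu⟩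
  have haU := h.mem_left_of_adj hw ha
  have hbU := h.mem_left_of_adj hw hb
  suffices hab : ∀ v ∈ W, ∀ c, G.Adj w c → G.Adj v c → G.Adj v a ∨ G.Adj v b by
    rcases rare_or_rare h hw ha hb hab with hr | hr
    exacts [⟨a, haU, hr⟩, ⟨b, hbU, hr⟩]
  intro v hv c hwc hvc
  by_contra! hcon
  obtain ⟨hva, hvb⟩ := hcon
  obtain ⟨K, hKo, hcK, hKv⟩ := hJ v hv c hvc (g c) (hg c hwc).2
  have haK : g a ∉ K := fun hK => hva ((hKv a haU).2 ⟨g a, hK, (hg a ha).2⟩)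
  have hbK : g b ∉ K := fun hK => hvb ((hKv b hbU).2 ⟨g b, hK, (hg b hb).2⟩)
  have hKJ : K ⊆ J := by
    intro y hy
    refine hJo.out (hg a ha).1 (hg b hb).1 ⟨?_, ?_⟩
    · by_contra! hlt
      exact haK (hKo.out hy hcK ⟨hlt.le, hamin c hwc⟩)
    · by_contra! hlt
      exact hbK (hKo.out hcK hy ⟨hbmax c hwc, hlt.le⟩)
  have hlt : G.neighborSet v ⊂ G.neighborSet w := by
    refine (Set.ssubset_iff_of_subset fun z hz => ?_).2 ⟨a, ha, hva⟩
    have hzU := h.mem_left_of_adj hv hz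
    exact (hJw z hzU).2 (Set.image_mono hKJ ((hKv z hzU).1 hz))
  exact (Set.ncard_lt_ncard hlt (Set.toFinite _)).not_ge (hmin v ⟨hv, c, hvc⟩)

theorem mem_image_Icc_add_int {a b : ℝ} {k : ℤ} {p : AddCircle (1 : ℝ)} :
    p ∈ (fun x : ℝ => (x : AddCircle (1 : ℝ))) '' Set.Icc (a + k) (b + k) ↔
      p ∈ (fun x : ℝ => (x : AddCircle (1 : ℝ))) '' Set.Icc a b := by
  have hk : ((k : ℝ) : AddCircle (1 : ℝ)) = 0 :=
    (AddCircle.coe_eq_zero_iff 1).2 ⟨k, by simp⟩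
  constructor
  · rintro ⟨x, hx, rfl⟩
    exact ⟨x - k, ⟨by linarith [hx.1], by linarith [hx.2]⟩, by simp [hk]⟩
  · rintro ⟨x, hx, rfl⟩
    exact ⟨x + k, ⟨by linarith [hx.1], by linarith [hx.2]⟩, by simp⟩

/-- The union of the arcs of a family that pass through a point `q` is the image of a real
interval, which can be moved to any lift of any of its points. -/
theorem exists_ordConnected_lift (ℐ : Set (Set (AddCircle (1 : ℝ))))
    (harc : ∀ I ∈ ℐ, ∃ a b : ℝ, I = (fun x : ℝ => (x : AddCircle (1 : ℝ))) '' Set.Icc a b)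
    {p q : AddCircle (1 : ℝ)} (hpq : ∃ I ∈ ℐ, p ∈ I ∧ q ∈ I) {x : ℝ}
    (hx : (x : AddCircle (1 : ℝ)) = p) :
    ∃ J : Set ℝ, J.OrdConnected ∧ x ∈ J ∧ ∀ r : AddCircle (1 : ℝ),
      (∃ I ∈ ℐ, r ∈ I ∧ q ∈ I) ↔ r ∈ (fun x : ℝ => (x : AddCircle (1 : ℝ))) '' J := by
  have hmove : ∀ I ∈ ℐ, ∀ s : ℝ, (s : AddCircle (1 : ℝ)) ∈ I → ∃ a b : ℝ,
      I = (fun x : ℝ => (x : AddCircle (1 : ℝ))) '' Set.Icc a b ∧ s ∈ Set.Icc a b := by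
    intro I hI s hs
    obtain ⟨a, b, rfl⟩ := harc I hI
    obtain ⟨t, ht, hts⟩ := hs
    obtain ⟨k, hk⟩ := (AddCircle.coe_eq_zero_iff (1 : ℝ) (x := s - t)).1
      (by rw [AddCircle.coe_sub, sub_eq_zero]; exact hts.symm)
    have hk' : (k : ℝ) = s - t := by simpa using hk
    exact ⟨a + k, b + k, Set.ext fun r => mem_image_Icc_add_int.symm,
      by linarith [ht.1], by linarith [ht.2]⟩
  obtain ⟨I, hI, hpI, hqI⟩ := hpq
  obtain ⟨a, b, hab, hxab⟩ := hmove I hI x (hx ▸ hpI)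
  obtain ⟨s, hs, rfl⟩ : q ∈ (fun x : ℝ => (x : AddCircle (1 : ℝ))) '' Set.Icc a b := hab ▸ hqI
  refine ⟨{y | ∃ a b : ℝ, (fun x : ℝ => (x : AddCircle (1 : ℝ))) '' Set.Icc a b ∈ ℐ ∧
    s ∈ Set.Icc a b ∧ y ∈ Set.Icc a b}, ⟨?_⟩, ⟨a, b, hab ▸ hI, hs, hxab⟩, fun r => ⟨?_, ?_⟩⟩
  · rintro y ⟨c, d, hcd, hs₁, hy⟩ z ⟨c', d', hcd', hs₂, hz⟩ t ⟨hyt, htz⟩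
    rcases le_total t s with hts | hst
    · exact ⟨c, d, hcd, hs₁, hy.1.trans hyt, hts.trans hs₁.2⟩
    · exact ⟨c', d', hcd', hs₂, hs₂.1.trans hst, htz.trans hz.2⟩
  · rintro ⟨K, hK, hrK, hsK⟩
    obtain ⟨c, d, rfl, hscd⟩ := hmove K hK s hsK
    obtain ⟨y, hy, rfl⟩ := hrK
    exact ⟨y, ⟨c, d, hK, hscd, hy⟩, rfl⟩
  · rintro ⟨y, ⟨c, d, hcd, hscd, hy⟩, rfl⟩
    exact ⟨_, hcd, ⟨y, hy, rfl⟩, ⟨s, hscd, rfl⟩⟩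

/-- Bipartitioned circular interval graphs satisfy Frankl's conjecture: the vertices are
points of the circle `ℝ/ℤ` partitioned into `U` and `W`, arcs are images of closed bounded
real intervals, and distinct vertices from different classes are adjacent exactly when some
arc contains both. If there is at least one edge, each class contains a rare vertex. -/
theorem bipartitioned_circular_interval_frankl
    (V U W : Finset (AddCircle (1 : ℝ))) (ℐ : Finset (Set (AddCircle (1 : ℝ))))
    (harc : ∀ I ∈ ℐ, ∃ a b : ℝ, I = (fun x : ℝ => (x : AddCircle (1 : ℝ))) '' Set.Icc a b)
    (hpart : U ∪ W = V) (hdisj : Disjoint U W)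
    (G : SimpleGraph {x // x ∈ V})
    (hG : G = SimpleGraph.fromRel (fun (u w : {x // x ∈ V}) =>
      (u : AddCircle (1 : ℝ)) ∈ U ∧ (w : AddCircle (1 : ℝ)) ∈ W ∧
        ∃ I ∈ ℐ, (u : AddCircle (1 : ℝ)) ∈ I ∧ (w : AddCircle (1 : ℝ)) ∈ I))
    (he : G.edgeSet.Nonempty) :
    (∃ u : {x // x ∈ V}, (u : AddCircle (1 : ℝ)) ∈ U ∧ Rare G u) ∧
    (∃ w : {x // x ∈ V}, (w : AddCircle (1 : ℝ)) ∈ W ∧ Rare G w) := by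

  have hadj : ∀ u w : {x // x ∈ V}, (u : AddCircle (1 : ℝ)) ∈ U → (w : AddCircle (1 : ℝ)) ∈ W →
      (G.Adj u w ↔ ∃ I ∈ ℐ, (u : AddCircle (1 : ℝ)) ∈ I ∧ (w : AddCircle (1 : ℝ)) ∈ I) := by
    intro u w hu hw
    have hw' : (w : AddCircle (1 : ℝ)) ∉ U := fun h => Finset.disjoint_left.1 hdisj h hw
    have hne : u ≠ w := by
      rintro rfl
      exact hw' hu
    simp [hG, SimpleGraph.fromRel_adj, hne, hu, hw, hw']
  have hbip : IsBipartition G {x | (x : AddCircle (1 : ℝ)) ∈ U}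
      {x | (x : AddCircle (1 : ℝ)) ∈ W} := by
    refine ⟨?_, ?_, ?_, ?_⟩
    · ext ⟨x, hx⟩
      simpa [← hpart] using hx
    · exact Set.disjoint_left.2 fun x hx hx' => Finset.disjoint_left.1 hdisj hx hx'
    · intro u hu v hv huv
      rw [hG, SimpleGraph.fromRel_adj] at huv
      rcases huv.2 with h | h
      exacts [Finset.disjoint_left.1 hdisj hv h.2.1, Finset.disjoint_left.1 hdisj hu h.2.1]
    · intro u hu v hv huv
      rw [hG, SimpleGraph.fromRel_adj] at huv
      rcases huv.2 with h | h
      exacts [Finset.disjoint_left.1 hdisj h.1 hu, Finset.disjoint_left.1 hdisj h.1 hv]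
  obtain ⟨u, w, hu, hw, huw⟩ : ∃ u w : {x // x ∈ V}, (u : AddCircle (1 : ℝ)) ∈ U ∧
      (w : AddCircle (1 : ℝ)) ∈ W ∧ G.Adj u w := by
    obtain ⟨e, he⟩ := he
    induction e using Sym2.ind with
    | _ x y =>
      have hxy : G.Adj x y := he
      rcases hbip.mem_or_mem x with hx | hx
      · exact ⟨x, y, hx, hbip.symm.mem_left_of_adj hx hxy, hxy⟩
      · exact ⟨y, x, hbip.mem_left_of_adj hx hxy, hx, hxy.symm⟩
  constructor
  · refine exists_rare_of_ordConnected hbip (fun x : ℝ => (x : AddCircle (1 : ℝ)))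
      QuotientAddGroup.mk_surjective Subtype.val ?_ ⟨w, hw, u, huw.symm⟩
    intro w hw u hwu x hx
    have hu := hbip.mem_left_of_adj hw hwu
    obtain ⟨J, hJ, hxJ, hJr⟩ :=
      exists_ordConnected_lift (ℐ : Set _) harc ((hadj u w hu hw).1 hwu.symm) hx
    exact ⟨J, hJ, hxJ, fun v hv => by rw [G.adj_comm, hadj v w hv hw]; exact hJr v⟩
  · refine exists_rare_of_ordConnected hbip.symm (fun x : ℝ => (x : AddCircle (1 : ℝ)))
      QuotientAddGroup.mk_surjective Subtype.val ?_ ⟨u, hu, w, huw⟩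
    intro u hu w huw x hx
    have hw := hbip.symm.mem_left_of_adj hu huw
    obtain ⟨I, hI, huI, hwI⟩ := (hadj u w hu hw).1 huw
    obtain ⟨J, hJ, hxJ, hJr⟩ :=
      exists_ordConnected_lift (ℐ : Set _) harc ⟨I, hI, hwI, huI⟩ hx
    refine ⟨J, hJ, hxJ, fun v hv => ?_⟩
    rw [hadj u v hu hv, ← hJr v]
    simp only [and_comm, Finset.mem_coe]
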